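/- Under the Gaussian box-decomposition setup, for every m, the first restricted standardized moment satisfies ∫ (ȳ m)·1_{f ∈ D} dP = − ρ m · Σ_{j=1}^J (W[j]/W[j,m]) · G[j,m]. -/

import Mathlib

open MeasureTheory ProbabilityTheory

noncomputable section

/-- The density of the standard normal distribution. -/
def stdPdf (z : ℝ) : ℝ := (Real.sqrt (2 * Real.pi))⁻¹ * Real.exp (-z ^ 2 / 2)

/-- The cumulative distribution function of the standard normal distribution. -/
def stdCdf (x : ℝ) : ℝ := ∫ z in Set.Iic x, stdPdf z

/-- The standardization map `γ m c = (c − μ m)/√(s m)`. -/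
def gam {M : ℕ} (μ s : Fin M → ℝ) (m : Fin M) (c : ℝ) : ℝ :=
  (c - μ m) / Real.sqrt (s m)

/-- `W[j,m] = Φ(γ m (u j m)) − Φ(γ m (l j m))`. -/
def Wjm {M J : ℕ} (μ s : Fin M → ℝ) (l u : Fin J → Fin M → ℝ) (j : Fin J) (m : Fin M) : ℝ :=
  stdCdf (gam μ s m (u j m)) - stdCdf (gam μ s m (l j m))

/-- `W[j] = ∏_m W[j,m]`. -/
def Wj {M J : ℕ} (μ s : Fin M → ℝ) (l u : Fin J → Fin M → ℝ) (j : Fin J) : ℝ :=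
  ∏ m, Wjm μ s l u j m

/-- `W = Σ_j W[j]`. -/
def Wtot {M J : ℕ} (μ s : Fin M → ℝ) (l u : Fin J → Fin M → ℝ) : ℝ :=
  ∑ j, Wj μ s l u j

/-- `G[j,m] = φ(γ m (u j m)) − φ(γ m (l j m))`. -/
def Gjm {M J : ℕ} (μ s : Fin M → ℝ) (l u : Fin J → Fin M → ℝ) (j : Fin J) (m : Fin M) : ℝ :=
  stdPdf (gam μ s m (u j m)) - stdPdf (gam μ s m (l j m))

/-- `V[j,m] = γ m (u j m)·φ(γ m (u j m)) − γ m (l j m)·φ(γ m (l j m))`. -/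
def Vjm {M J : ℕ} (μ s : Fin M → ℝ) (l u : Fin J → Fin M → ℝ) (j : Fin J) (m : Fin M) : ℝ :=
  gam μ s m (u j m) * stdPdf (gam μ s m (u j m))
    - gam μ s m (l j m) * stdPdf (gam μ s m (l j m))

/-- `ρ m = √(s m / (s m + σ m))`. -/
def rho {M : ℕ} (s σ : Fin M → ℝ) (m : Fin M) : ℝ := Real.sqrt (s m / (s m + σ m))

/-- The union `D = ⋃_j B j` of the boxes `B j`. -/
def boxD {M J : ℕ} (l u : Fin J → Fin M → ℝ) : Set (Fin M → ℝ) :=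
  ⋃ j, {z : Fin M → ℝ | ∀ m, l j m < z m ∧ z m ≤ u j m}

/-- The joint law of `(f, ε)`: the product of the two product Gaussian measures
`⨂_m N(μ m, s m)` and `⨂_m N(0, σ m)`. -/
def Pmeas {M : ℕ} (μ s σ : Fin M → ℝ) : Measure ((Fin M → ℝ) × (Fin M → ℝ)) :=
  (Measure.pi fun m => gaussianReal (μ m) (s m).toNNReal).prod
    (Measure.pi fun m => gaussianReal 0 (σ m).toNNReal)

end

theorem continuous_stdPdf : Continuous stdPdf := by
  unfold stdPdf
  fun_prop

theorem stdPdf_pos (z : ℝ) : 0 < stdPdf z := by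
  unfold stdPdf
  positivity

theorem stdPdf_eq_gaussianPDFReal : stdPdf = gaussianPDFReal 0 1 := by
  ext z
  simp [stdPdf, gaussianPDFReal]

theorem integrable_stdPdf : Integrable stdPdf := by
  rw [stdPdf_eq_gaussianPDFReal]
  exact integrable_gaussianPDFReal 0 1

theorem hasDerivAt_neg_stdPdf (z : ℝ) : HasDerivAt (fun x => -stdPdf x) (z * stdPdf z) z := by
  have h : HasDerivAt (fun x : ℝ => -x ^ 2 / 2) (-z) z := by
    convert! ((hasDerivAt_pow 2 z).neg.div_const 2) using 1
    norm_num
    ring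
  convert! (h.exp.const_mul (Real.sqrt (2 * Real.pi))⁻¹).neg using 1
  simp only [stdPdf]
  ring

theorem stdCdf_sub_eq_intervalIntegral (a b : ℝ) :
    stdCdf b - stdCdf a = ∫ z in a..b, stdPdf z :=
  intervalIntegral.integral_Iic_sub_Iic integrable_stdPdf.integrableOn
    integrable_stdPdf.integrableOn

theorem stdCdf_strictMono : StrictMono stdCdf := by
  intro a b hab
  rw [← sub_pos, stdCdf_sub_eq_intervalIntegral]
  exact intervalIntegral.intervalIntegral_pos_of_pos
    (continuous_stdPdf.intervalIntegrable _ _) stdPdf_pos hab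

theorem intervalIntegral_mul_stdPdf (a b : ℝ) :
    ∫ z in a..b, z * stdPdf z = -(stdPdf b - stdPdf a) := by
  rw [intervalIntegral.integral_eq_sub_of_hasDerivAt (fun z _ => hasDerivAt_neg_stdPdf z)
    ((continuous_id.mul continuous_stdPdf).intervalIntegrable _ _)]
  ring

/-- Standardization of an integral over a half-open interval against a Gaussian measure. -/
theorem integral_gaussianReal_mul_indicator_Ioc (μ : ℝ) {s a b : ℝ} (hs : 0 < s) (hab : a ≤ b)
    (g : ℝ → ℝ) :
    ∫ x, g ((x - μ) / √s) * (Set.Ioc a b).indicator 1 x ∂gaussianReal μ s.toNNReal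
      = ∫ z in ((a - μ) / √s)..((b - μ) / √s), g z * stdPdf z := by
  have hr : 0 < √s := Real.sqrt_pos.2 hs
  have hmap : gaussianReal μ s.toNNReal = (gaussianReal 0 1).map (fun x => √s * x + μ) := by
    have := gaussianReal_map_const_mul (μ := 0) (v := 1) (√s)
    have hcomp : (fun x => √s * x + μ) = (· + μ) ∘ (√s * ·) := rfl
    rw [hcomp, ← Measure.map_map (by fun_prop) (by fun_prop), this, gaussianReal_map_add_const]
    congr 1
    · simp
    · ext
      simp [Real.sq_sqrt hs.le, hs.le]
  have hemb : MeasurableEmbedding (fun x : ℝ => √s * x + μ) :=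
    ((Homeomorph.mulLeft₀ (√s) hr.ne').trans (Homeomorph.addRight μ)).measurableEmbedding
  rw [hmap, hemb.integral_map, integral_gaussianReal_eq_integral_smul one_ne_zero,
    intervalIntegral.integral_of_le (by gcongr), ← integral_indicator measurableSet_Ioc,
    ← stdPdf_eq_gaussianPDFReal]
  congr 1
  ext z
  have hmem : √s * z + μ ∈ Set.Ioc a b ↔ z ∈ Set.Ioc ((a - μ) / √s) ((b - μ) / √s) := by
    rw [Set.mem_Ioc, Set.mem_Ioc, div_lt_iff₀ hr, le_div_iff₀ hr, mul_comm z]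
    constructor <;> rintro ⟨h, h'⟩ <;> constructor <;> linarith
  have hz : (√s * z + μ - μ) / √s = z := by
    field_simp
    ring
  by_cases h : z ∈ Set.Ioc ((a - μ) / √s) ((b - μ) / √s)
  · rw [Set.indicator_of_mem h, Set.indicator_of_mem (hmem.2 h), hz]
    simp [mul_comm]
  · simp [Set.indicator_of_notMem h, Set.indicator_of_notMem (mt hmem.1 h)]

theorem integral_gaussianReal_indicator_Ioc (μ : ℝ) {s a b : ℝ} (hs : 0 < s) (hab : a ≤ b) :
    ∫ x, (Set.Ioc a b).indicator 1 x ∂gaussianReal μ s.toNNReal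
      = stdCdf ((b - μ) / √s) - stdCdf ((a - μ) / √s) := by
  simpa [stdCdf_sub_eq_intervalIntegral] using
    integral_gaussianReal_mul_indicator_Ioc μ hs hab (fun _ => 1)

theorem integral_gaussianReal_standardized_mul_indicator_Ioc (μ : ℝ) {s a b : ℝ} (hs : 0 < s)
    (hab : a ≤ b) :
    ∫ x, (x - μ) / √s * (Set.Ioc a b).indicator 1 x ∂gaussianReal μ s.toNNReal
      = -(stdPdf ((b - μ) / √s) - stdPdf ((a - μ) / √s)) := by
  rw [← intervalIntegral_mul_stdPdf]
  exact integral_gaussianReal_mul_indicator_Ioc μ hs hab id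

theorem integrable_eval_pi_gaussianReal {ι : Type*} [Fintype ι] (μ : ι → ℝ) (v : ι → NNReal)
    (i : ι) : Integrable (fun z => z i) (Measure.pi fun i => gaussianReal (μ i) (v i)) :=
  (measurePreserving_eval (fun i => gaussianReal (μ i) (v i)) i).integrable_comp_of_integrable
    ((memLp_id_gaussianReal 1).integrable le_rfl)

theorem integral_eval_pi_gaussianReal {ι : Type*} [Fintype ι] (μ : ι → ℝ) (v : ι → NNReal)
    (i : ι) : ∫ z, z i ∂(Measure.pi fun i => gaussianReal (μ i) (v i)) = μ i := by
  have h := (measurePreserving_eval (fun i => gaussianReal (μ i) (v i)) i).map_eq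
  rw [← integral_id_gaussianReal (μ := μ i) (v := v i), ← h,
    integral_map (measurable_pi_apply i).aemeasurable (by fun_prop)]

/-- The half-open box with lower corner `a` and upper corner `b`. -/
def halfOpenBox {ι : Type*} (a b : ι → ℝ) : Set (ι → ℝ) := {z | ∀ i, a i < z i ∧ z i ≤ b i}

theorem measurableSet_halfOpenBox {ι : Type*} [Fintype ι] (a b : ι → ℝ) :
    MeasurableSet (halfOpenBox a b) := by
  have : halfOpenBox a b = Set.univ.pi fun i => Set.Ioc (a i) (b i) := by
    ext z
    simp [halfOpenBox]
  rw [this]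
  exact MeasurableSet.univ_pi fun _ => measurableSet_Ioc

theorem indicator_halfOpenBox {ι : Type*} [Fintype ι] (a b z : ι → ℝ) :
    (halfOpenBox a b).indicator (fun _ => (1 : ℝ)) z
      = ∏ i, (Set.Ioc (a i) (b i)).indicator 1 (z i) := by
  classical
  simp only [Set.indicator_apply, Pi.one_apply, Finset.prod_ite_zero]
  simp only [halfOpenBox, Set.mem_ofPred_eq, Set.mem_Ioc, Finset.mem_univ, true_imp_iff,
    Finset.prod_const_one]
  congr

/-- The standardized first moment of one coordinate of a Gaussian vector with independent
coordinates, restricted to a box. -/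
theorem integral_pi_gaussianReal_standardized_mul_indicator {ι : Type*} [Fintype ι]
    [DecidableEq ι] (μ s a b : ι → ℝ) (hs : ∀ i, 0 < s i) (hab : ∀ i, a i ≤ b i) (m : ι) :
    ∫ z, (z m - μ m) / √(s m) * (halfOpenBox a b).indicator (fun _ => (1 : ℝ)) z
        ∂(Measure.pi fun i => gaussianReal (μ i) (s i).toNNReal)
      = -(stdPdf ((b m - μ m) / √(s m)) - stdPdf ((a m - μ m) / √(s m)))
        * ∏ i ∈ Finset.univ.erase m,
          (stdCdf ((b i - μ i) / √(s i)) - stdCdf ((a i - μ i) / √(s i))) := by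
  let g : ι → ℝ → ℝ := fun i x =>
    (if i = m then (x - μ i) / √(s i) else 1) * (Set.Ioc (a i) (b i)).indicator 1 x
  have hg : ∀ z : ι → ℝ, (z m - μ m) / √(s m) * (halfOpenBox a b).indicator (fun _ => (1 : ℝ)) z
      = ∏ i, g i (z i) := by
    intro z
    simp only [g, indicator_halfOpenBox]
    rw [Finset.prod_mul_distrib]
    simp
  simp_rw [hg]
  rw [integral_fintype_prod_eq_prod, ← Finset.mul_prod_erase _ _ (Finset.mem_univ m)]
  congr 1
  · simpa [g] using
      integral_gaussianReal_standardized_mul_indicator_Ioc (μ m) (hs m) (hab m)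
  · refine Finset.prod_congr rfl fun i hi => ?_
    simpa [g, Finset.ne_of_mem_erase hi] using
      integral_gaussianReal_indicator_Ioc (μ i) (hs i) (hab i)

theorem boxD_eq_iUnion_halfOpenBox {M J : ℕ} (l u : Fin J → Fin M → ℝ) :
    boxD l u = ⋃ j, halfOpenBox (l j) (u j) := rfl

theorem indicator_boxD {M J : ℕ} (l u : Fin J → Fin M → ℝ)
    (hdisj : Pairwise fun j j' : Fin J =>
      Disjoint (halfOpenBox (l j) (u j)) (halfOpenBox (l j') (u j'))) (z : Fin M → ℝ) :
    (boxD l u).indicator (fun _ => (1 : ℝ)) z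
      = ∑ j, (halfOpenBox (l j) (u j)).indicator (fun _ => (1 : ℝ)) z := by
  have h := Finset.indicator_biUnion_apply Finset.univ (fun j => halfOpenBox (l j) (u j))
    (f := fun _ => (1 : ℝ)) (fun j _ j' _ hjj' => hdisj hjj') z
  simpa [boxD_eq_iUnion_halfOpenBox] using h

theorem Wjm_pos {M J : ℕ} (μ s : Fin M → ℝ) (l u : Fin J → Fin M → ℝ) (hs : ∀ m, 0 < s m)
    (hlu : ∀ j m, l j m < u j m) (j : Fin J) (m : Fin M) : 0 < Wjm μ s l u j m := by
  have hr : 0 < √(s m) := Real.sqrt_pos.2 (hs m)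
  refine sub_pos.2 (stdCdf_strictMono ?_)
  simp only [gam]
  gcongr
  exact hlu j m

theorem Wj_div_Wjm {M J : ℕ} (μ s : Fin M → ℝ) (l u : Fin J → Fin M → ℝ) (hs : ∀ m, 0 < s m)
    (hlu : ∀ j m, l j m < u j m) (j : Fin J) (m : Fin M) :
    Wj μ s l u j / Wjm μ s l u j m = ∏ i ∈ Finset.univ.erase m, Wjm μ s l u j i := by
  rw [Wj, ← Finset.mul_prod_erase _ _ (Finset.mem_univ m),
    mul_div_cancel_left₀ _ (Wjm_pos μ s l u hs hlu j m).ne']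

/-- First restricted standardized moment:
`∫ (ȳ m)·1_{f ∈ D} dP = − ρ m · Σ_j (W[j]/W[j,m]) · G[j,m]`. -/
theorem first_restricted_standardized_moment
    (M J : ℕ) (hM : 1 ≤ M) (hJ : 1 ≤ J)
    (μ s σ : Fin M → ℝ) (hs : ∀ m, 0 < s m) (hσ : ∀ m, 0 ≤ σ m)
    (l u : Fin J → Fin M → ℝ) (hlu : ∀ j m, l j m < u j m)
    (hdisj : Pairwise fun j j' : Fin J => Disjoint
        {z : Fin M → ℝ | ∀ m, l j m < z m ∧ z m ≤ u j m}
        {z : Fin M → ℝ | ∀ m, l j' m < z m ∧ z m ≤ u j' m})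
    (m : Fin M) :
    ∫ p, ((p.1 m + p.2 m - μ m) / Real.sqrt (s m + σ m))
        * Set.indicator (boxD l u) (fun _ => (1 : ℝ)) p.1 ∂(Pmeas μ s σ)
      = - rho s σ m * ∑ j, (Wj μ s l u j / Wjm μ s l u j m) * Gjm μ s l u j m := by
  have hD : MeasurableSet (boxD l u) :=
    MeasurableSet.iUnion fun j => measurableSet_halfOpenBox (l j) (u j)
  set ν := Measure.pi fun m => gaussianReal (μ m) (s m).toNNReal with hν
  set η := Measure.pi fun m => gaussianReal 0 (σ m).toNNReal with hη
  have hf (A : Set (Fin M → ℝ)) (hA : MeasurableSet A) :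
      Integrable (fun z => (z m - μ m) / √(s m) * A.indicator (fun _ => (1 : ℝ)) z) ν := by
    have h := ((integrable_eval_pi_gaussianReal μ (fun i => (s i).toNNReal) m).sub
      (integrable_const (μ m))).div_const (√(s m))
    convert! h.indicator hA using 1
    ext z
    by_cases hz : z ∈ A <;> simp [hz]
  have hind : Integrable ((boxD l u).indicator fun _ => (1 : ℝ)) ν :=
    (integrable_const 1).indicator hD
  have hε : Integrable (fun z => z m / √(s m + σ m)) η :=
    (integrable_eval_pi_gaussianReal _ _ m).div_const _
  have hε0 : ∫ z, z m / √(s m + σ m) ∂η = 0 := by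
    rw [integral_div, hη, integral_eval_pi_gaussianReal, zero_div]
  have hfD : ∫ z, (z m - μ m) / √(s m) * (boxD l u).indicator (fun _ => (1 : ℝ)) z ∂ν
      = -∑ j, (Wj μ s l u j / Wjm μ s l u j m) * Gjm μ s l u j m := by
    simp_rw [indicator_boxD l u hdisj, Finset.mul_sum]
    rw [integral_finsetSum _ fun j _ => hf _ (measurableSet_halfOpenBox _ _),
      ← Finset.sum_neg_distrib]
    refine Finset.sum_congr rfl fun j _ => ?_
    rw [hν, integral_pi_gaussianReal_standardized_mul_indicator μ s _ _ hs
      (fun i => (hlu j i).le), Wj_div_Wjm μ s l u hs hlu]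
    simp only [Gjm, Wjm, gam]
    ring
  have hsplit : ∀ p : (Fin M → ℝ) × (Fin M → ℝ),
      (p.1 m + p.2 m - μ m) / √(s m + σ m) * (boxD l u).indicator (fun _ => (1 : ℝ)) p.1
      = ((p.1 m - μ m) / √(s m) * (boxD l u).indicator (fun _ => (1 : ℝ)) p.1) * rho s σ m
        + (boxD l u).indicator (fun _ => (1 : ℝ)) p.1 * (p.2 m / √(s m + σ m)) := by
    intro p
    have hr : √(s m) ≠ 0 := (Real.sqrt_pos.2 (hs m)).ne'
    have hr' : √(s m + σ m) ≠ 0 := (Real.sqrt_pos.2 (add_pos_of_pos_of_nonneg (hs m) (hσ m))).ne'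
    rw [rho, Real.sqrt_div (hs m).le]
    field_simp
    ring
  simp_rw [hsplit]
  rw [Pmeas, ← hν, ← hη, integral_add ((hf _ hD).mul_prod (integrable_const _))
    (hind.mul_prod hε), integral_prod_mul (μ := ν) (ν := η)
      (fun z => (z m - μ m) / √(s m) * (boxD l u).indicator (fun _ => (1 : ℝ)) z)
      (fun _ => rho s σ m),
    integral_prod_mul (μ := ν) (ν := η) ((boxD l u).indicator fun _ => (1 : ℝ))
      (fun z => z m / √(s m + σ m)), hε0, hfD]
  simp
  ring
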